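/- Let k be an algebraically closed field with char(k) ≠ 3 and let λ ∈ k with λ³ ≠ 1 and the curve C_λ: x³ + y³ + z³ − 3λxyz = 0 smooth. Then the inflection points of C_λ are the nine points [1,ε,0], [1,0,ε], [0,1,ε] with ε³ + 1 = 0, and the inflection lines of C_λ are the nine lines x + ωy + λω²z = 0, x + λω²y + ωz = 0, λω²x + y + ωz = 0 with ω³ = 1. Moreover, if λ ≠ 0, the sextic (λx² − yz)(λy² − xz)(λz² − xy) = 0 in the dual plane is a reduced connected curve passing doubly through all nine points dual to these inflection lines. -/

import Mathlib

/-!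
STATEMENT 19 (Pacini–Testa, proof of Lemma `tu`): over an algebraically closed field
`k` with `char k ≠ 3`, for `λ ∈ k` with `λ³ ≠ 1` and `C_λ : x³+y³+z³−3λxyz = 0` smooth:
the inflection points of `C_λ` are the nine points `[1,ε,0], [1,0,ε], [0,1,ε]` with
`ε³ + 1 = 0`; the inflection lines are the nine lines `x + ωy + λω²z = 0`,
`x + λω²y + ωz = 0`, `λω²x + y + ωz = 0` with `ω³ = 1`; and, if `λ ≠ 0`, the sextic
`(λx² − yz)(λy² − xz)(λz² − xy) = 0` in the dual plane is a reduced connected curve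
passing doubly through all nine points dual to these inflection lines.
-/

open MvPolynomial Polynomial

noncomputable section

namespace Infl

variable {K : Type*} [Field K]

def dotv (w p : Fin 3 → K) : K := ∑ i, w i * p i

def lineRestrict (F : MvPolynomial (Fin 3) K) (a b : Fin 3 → K) : Polynomial K :=
  MvPolynomial.aeval (fun i => Polynomial.C (a i) + Polynomial.C (b i) * Polynomial.X) F

def contactAt (F : MvPolynomial (Fin 3) K) (a b : Fin 3 → K) : ℕ :=
  (lineRestrict F a b).rootMultiplicity 0

def IsSmoothCurve (F : MvPolynomial (Fin 3) K) (d : ℕ) : Prop :=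
  F.IsHomogeneous d ∧ F ≠ 0 ∧
    ∀ p : Fin 3 → K, p ≠ 0 → eval p F = 0 → ∃ i, eval p (pderiv i F) ≠ 0

def IsInflLine (F : MvPolynomial (Fin 3) K) (w : Fin 3 → K) : Prop :=
  w ≠ 0 ∧ ∃ a b : Fin 3 → K, dotv w a = 0 ∧ dotv w b = 0 ∧
    LinearIndependent K ![a, b] ∧ lineRestrict F a b ≠ 0 ∧ 3 ≤ contactAt F a b

def IsInflPoint (F : MvPolynomial (Fin 3) K) (p : Fin 3 → K) : Prop :=
  eval p F = 0 ∧ ∃ b : Fin 3 → K, LinearIndependent K ![p, b] ∧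
    lineRestrict F p b ≠ 0 ∧ 3 ≤ contactAt F p b

def propor (p q : Fin 3 → K) : Prop := ∃ c : K, c ≠ 0 ∧ p = c • q

/-- `G` vanishes doubly at `w` (point of multiplicity at least two). -/
def SingAt (F : MvPolynomial (Fin 3) K) (p : Fin 3 → K) : Prop :=
  eval p F = 0 ∧ ∀ i, eval p (pderiv i F) = 0

/-- The Hesse pencil member `x³ + y³ + z³ − 3λ·xyz`. -/
def hessePencil (lam : K) : MvPolynomial (Fin 3) K :=
  X 0 ^ 3 + X 1 ^ 3 + X 2 ^ 3 - MvPolynomial.C (3 * lam) * (X 0 * X 1 * X 2)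

/-- The sextic `(λx² − yz)(λy² − xz)(λz² − xy)` (in the coordinates of the dual plane). -/
def hesseSextic (lam : K) : MvPolynomial (Fin 3) K :=
  (MvPolynomial.C lam * X 0 ^ 2 - X 1 * X 2) * (MvPolynomial.C lam * X 1 ^ 2 - X 0 * X 2) *
    (MvPolynomial.C lam * X 2 ^ 2 - X 0 * X 1)

theorem lineRestrict_hesse (lam : K) (a b : Fin 3 → K) :
    lineRestrict (hessePencil lam) a b =
      Polynomial.C (a 0 ^ 3 + a 1 ^ 3 + a 2 ^ 3 - 3 * lam * (a 0 * a 1 * a 2)) +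
      Polynomial.C (3 * (a 0 ^ 2 * b 0 + a 1 ^ 2 * b 1 + a 2 ^ 2 * b 2
        - lam * (b 0 * a 1 * a 2 + a 0 * b 1 * a 2 + a 0 * a 1 * b 2))) * Polynomial.X +
      Polynomial.C (3 * (a 0 * b 0 ^ 2 + a 1 * b 1 ^ 2 + a 2 * b 2 ^ 2
        - lam * (a 0 * b 1 * b 2 + b 0 * a 1 * b 2 + b 0 * b 1 * a 2))) * Polynomial.X ^ 2 +
      Polynomial.C (b 0 ^ 3 + b 1 ^ 3 + b 2 ^ 3 - 3 * lam * (b 0 * b 1 * b 2)) *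
        Polynomial.X ^ 3 := by
  simp only [lineRestrict, hessePencil, map_add, map_sub, map_mul, map_pow, MvPolynomial.aeval_X,
    MvPolynomial.algHom_C, Polynomial.algebraMap_eq]
  have e3 : (Polynomial.C (3 : K)) = 3 := rfl
  rw [e3]
  ring

theorem cubic_contact (c0 c1 c2 c3 : K) :
    ((Polynomial.C c0 + Polynomial.C c1 * Polynomial.X + Polynomial.C c2 * Polynomial.X ^ 2 +
      Polynomial.C c3 * Polynomial.X ^ 3 ≠ 0 ∧
      3 ≤ (Polynomial.C c0 + Polynomial.C c1 * Polynomial.X + Polynomial.C c2 * Polynomial.X ^ 2 +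
      Polynomial.C c3 * Polynomial.X ^ 3).rootMultiplicity 0) ↔
      c0 = 0 ∧ c1 = 0 ∧ c2 = 0 ∧ c3 ≠ 0) := by
  constructor
  · rintro ⟨h0, h⟩
    rw [Polynomial.le_rootMultiplicity_iff h0, Polynomial.C_0, sub_zero,
      Polynomial.X_pow_dvd_iff] at h
    have e0 := h 0 (by norm_num)
    have e1 := h 1 (by norm_num)
    have e2 := h 2 (by norm_num)
    simp [Polynomial.coeff_X, Polynomial.coeff_X_pow] at e0 e1 e2
    subst e0 e1 e2
    refine ⟨rfl, rfl, rfl, ?_⟩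
    rintro rfl
    simp at h0
  · rintro ⟨rfl, rfl, rfl, h⟩
    have h0 : (Polynomial.C 0 + Polynomial.C 0 * Polynomial.X +
      Polynomial.C 0 * Polynomial.X ^ 2 + Polynomial.C c3 * Polynomial.X ^ 3) ≠ 0 := by
      simp [h]
    refine ⟨h0, ?_⟩
    rw [Polynomial.le_rootMultiplicity_iff h0]
    simp

theorem contact_hesse (h3 : (3 : K) ≠ 0) (lam : K) (a b : Fin 3 → K) :
    (lineRestrict (hessePencil lam) a b ≠ 0 ∧ 3 ≤ contactAt (hessePencil lam) a b) ↔
      a 0 ^ 3 + a 1 ^ 3 + a 2 ^ 3 - 3 * lam * (a 0 * a 1 * a 2) = 0 ∧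
      a 0 ^ 2 * b 0 + a 1 ^ 2 * b 1 + a 2 ^ 2 * b 2
        - lam * (b 0 * a 1 * a 2 + a 0 * b 1 * a 2 + a 0 * a 1 * b 2) = 0 ∧
      a 0 * b 0 ^ 2 + a 1 * b 1 ^ 2 + a 2 * b 2 ^ 2
        - lam * (a 0 * b 1 * b 2 + b 0 * a 1 * b 2 + b 0 * b 1 * a 2) = 0 ∧
      b 0 ^ 3 + b 1 ^ 3 + b 2 ^ 3 - 3 * lam * (b 0 * b 1 * b 2) ≠ 0 := by
  rw [contactAt, lineRestrict_hesse, cubic_contact]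
  simp only [mul_eq_zero, h3, false_or]

theorem eval_hesse (lam : K) (p : Fin 3 → K) : eval p (hessePencil lam) =
    p 0 ^ 3 + p 1 ^ 3 + p 2 ^ 3 - 3 * lam * (p 0 * p 1 * p 2) := by
  simp [hessePencil]

/-- Two independent vectors orthogonal to `w`: any other vector orthogonal to both is
a multiple of `w`; we phrase this with the cross product of the two vectors. -/
theorem cross_ne_zero (a b : Fin 3 → K) (h : LinearIndependent K ![a, b]) :
    a 1 * b 2 - a 2 * b 1 ≠ 0 ∨ a 2 * b 0 - a 0 * b 2 ≠ 0 ∨ a 0 * b 1 - a 1 * b 0 ≠ 0 := by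
  rw [LinearIndependent.pair_iff] at h
  by_contra! hc
  obtain ⟨h0, h1, h2⟩ := hc
  have key : ∀ i, b i = 0 := by
    intro i
    have := h (b i) (-a i) (by
      ext j
      fin_cases i <;> fin_cases j <;> simp <;>
        first
          | ring1
          | linear_combination h0
          | linear_combination -h0
          | linear_combination h1
          | linear_combination -h1
          | linear_combination h2
          | linear_combination -h2)
    exact this.1
  have := h 0 1 (by ext j; simp [key])
  simp at this

theorem orth_mult (a b g : Fin 3 → K) (h : LinearIndependent K ![a, b])
    (ha : dotv g a = 0) (hb : dotv g b = 0) :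
    ∃ c : K, g = c • ![a 1 * b 2 - a 2 * b 1, a 2 * b 0 - a 0 * b 2, a 0 * b 1 - a 1 * b 0] := by
  simp only [dotv, Fin.sum_univ_three] at ha hb
  rcases cross_ne_zero a b h with h | h | h
  · refine ⟨g 0 / (a 1 * b 2 - a 2 * b 1), ?_⟩
    ext j
    fin_cases j <;> simp <;> field_simp <;> grind
  · refine ⟨g 1 / (a 2 * b 0 - a 0 * b 2), ?_⟩
    ext j
    fin_cases j <;> simp <;> field_simp <;> grind
  · refine ⟨g 2 / (a 0 * b 1 - a 1 * b 0), ?_⟩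
    ext j
    fin_cases j <;> simp <;> field_simp <;> grind

/-- The (rescaled) gradient of the Hesse cubic. -/
def hgrad (lam : K) (p : Fin 3 → K) : Fin 3 → K :=
  ![p 0 ^ 2 - lam * (p 1 * p 2), p 1 ^ 2 - lam * (p 0 * p 2), p 2 ^ 2 - lam * (p 0 * p 1)]

/-- The nine points. -/
theorem infl_pts (h3 : (3 : K) ≠ 0) (lam : K) (hlam : lam ^ 3 ≠ 1) (a b : Fin 3 → K)
    (hab : LinearIndependent K ![a, b])
    (hc : lineRestrict (hessePencil lam) a b ≠ 0 ∧ 3 ≤ contactAt (hessePencil lam) a b) :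
    ∃ ε : K, ε ^ 3 + 1 = 0 ∧
          (propor a ![1, ε, 0] ∨ propor a ![1, 0, ε] ∨ propor a ![0, 1, ε]) := by
  rw [contact_hesse h3] at hc
  obtain ⟨c0, c1, c2, -⟩ := hc
  have ha0 : a ≠ 0 := by simpa using hab.ne_zero 0
  obtain ⟨c, hg⟩ := orth_mult a b (hgrad lam a) hab
    (by simp [dotv, Fin.sum_univ_three, hgrad]; linear_combination c0)
    (by simp [dotv, Fin.sum_univ_three, hgrad]; linear_combination c1)
  have g1 := congrFun hg 1
  have g2 := congrFun hg 2
  simp [hgrad] at g1 g2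
  have key : (lam ^ 3 - 1) * (a 0 ^ 3 * a 1 * a 2) = 0 := by
    have e1 : (lam ^ 3 - 1) * (a 0 ^ 3 * a 1 * a 2) =
        a 1 * (a 2 ^ 2 - lam * (a 0 * a 1)) ^ 2 + a 2 * (a 1 ^ 2 - lam * (a 0 * a 2)) ^ 2 +
        lam * a 0 * (a 1 ^ 2 - lam * (a 0 * a 2)) * (a 2 ^ 2 - lam * (a 0 * a 1)) := by
      linear_combination (-(a 1 * a 2)) * c0
    rw [e1, g1, g2]
    linear_combination c ^ 2 * a 0 ^ 2 * c2 - 2 * c ^ 2 * a 0 * b 0 * c1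
      + c ^ 2 * b 0 ^ 2 * c0
  have hl : lam ^ 3 - 1 ≠ 0 := sub_ne_zero.mpr hlam
  have hz : a 0 = 0 ∨ a 1 = 0 ∨ a 2 = 0 := by
    simpa [hl, or_assoc] using key
  rcases hz with h | h | h
  · have h1 : a 1 ≠ 0 := by
      intro h1
      apply ha0
      ext j
      fin_cases j
      · exact h
      · exact h1
      · simpa [h, h1] using c0
    refine ⟨a 2 / a 1, ?_, Or.inr (Or.inr ⟨a 1, h1, ?_⟩)⟩
    · field_simp
      simp [h] at c0
      linear_combination c0
    · ext j
      fin_cases j <;> simp [h]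
      field_simp
  · have h1 : a 0 ≠ 0 := by
      intro h1
      apply ha0
      ext j
      fin_cases j
      · exact h1
      · exact h
      · simpa [h, h1] using c0
    refine ⟨a 2 / a 0, ?_, Or.inr (Or.inl ⟨a 0, h1, ?_⟩)⟩
    · field_simp
      simp [h] at c0
      linear_combination c0
    · ext j
      fin_cases j <;> simp [h]
      field_simp
  · have h1 : a 0 ≠ 0 := by
      intro h1
      apply ha0
      ext j
      fin_cases j
      · exact h1
      · simpa [h, h1] using c0
      · exact h
    refine ⟨a 1 / a 0, ?_, Or.inl ⟨a 0, h1, ?_⟩⟩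
    · field_simp
      simp [h] at c0
      linear_combination c0
    · ext j
      fin_cases j <;> simp [h]
      field_simp

/-- For each of the nine points, an explicit second point on its inflection line. -/
theorem infl_conv (h3 : (3 : K) ≠ 0) (lam : K) (hlam : lam ^ 3 ≠ 1) (ε : K)
    (hε : ε ^ 3 + 1 = 0) (a b : Fin 3 → K) (c : K) (hc : c ≠ 0)
    (h : (a = c • ![1, ε, 0] ∧ b = ![0, lam, ε]) ∨ (a = c • ![1, 0, ε] ∧ b = ![0, ε, lam]) ∨
      (a = c • ![0, 1, ε] ∧ b = ![ε, 0, lam])) :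
    LinearIndependent K ![a, b] ∧
      lineRestrict (hessePencil lam) a b ≠ 0 ∧ 3 ≤ contactAt (hessePencil lam) a b := by
  have hε0 : ε ≠ 0 := by
    rintro rfl
    simp at hε
  have hl : lam ^ 3 - 1 ≠ 0 := sub_ne_zero.mpr hlam
  rw [contact_hesse h3, LinearIndependent.pair_iff]
  rcases h with ⟨rfl, rfl⟩ | ⟨rfl, rfl⟩ | ⟨rfl, rfl⟩
  · refine ⟨fun s t hst => ?_, ?_, ?_, ?_, ?_⟩
    · have e0 := congrFun hst 0
      have e1 := congrFun hst 1
      have e2 := congrFun hst 2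
      simp [hc, hε0] at e0 e1 e2
      exact ⟨e0, e2⟩
    · simp; linear_combination c ^ 3 * hε
    · simp; ring
    · simp; ring
    · simp; intro h'; apply hl; linear_combination h' - hε
  · refine ⟨fun s t hst => ?_, ?_, ?_, ?_, ?_⟩
    · have e0 := congrFun hst 0
      have e1 := congrFun hst 1
      have e2 := congrFun hst 2
      simp [hc, hε0] at e0 e1 e2
      exact ⟨e0, e1⟩
    · simp; linear_combination c ^ 3 * hε
    · simp; ring
    · simp; ring
    · simp; intro h'; apply hl; linear_combination h' - hε
  · refine ⟨fun s t hst => ?_, ?_, ?_, ?_, ?_⟩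
    · have e0 := congrFun hst 0
      have e1 := congrFun hst 1
      have e2 := congrFun hst 2
      simp [hc, hε0] at e0 e1 e2
      exact ⟨e1, e0⟩
    · simp; linear_combination c ^ 3 * hε
    · simp; ring
    · simp; ring
    · simp; intro h'; apply hl; linear_combination h' - hε

/-- The conics making up the sextic are irreducible. -/
theorem conic_irred (lam : K) (hl : lam ≠ 0) (i j l : Fin 3) (hij : i ≠ j) (hjl : j ≠ l)
    (hil : i ≠ l) :
    Irreducible (MvPolynomial.C lam * MvPolynomial.X i ^ 2 -
      MvPolynomial.X j * MvPolynomial.X l : MvPolynomial (Fin 3) K) := by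
  have e : (MvPolynomial.C lam * MvPolynomial.X i ^ 2 -
      MvPolynomial.X j * MvPolynomial.X l : MvPolynomial (Fin 3) K) =
      (-MvPolynomial.X l) * MvPolynomial.X j + MvPolynomial.C lam * MvPolynomial.X i ^ 2 := by
    ring
  rw [e]
  apply MvPolynomial.irreducible_mul_X_add
  · simp
  · rw [MvPolynomial.vars_neg, MvPolynomial.vars_X]
    simpa using hjl
  · intro h
    have h' := MvPolynomial.vars_mul _ _ h
    rw [MvPolynomial.vars_C, Finset.empty_union] at h'
    have h'' := MvPolynomial.vars_pow _ _ h'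
    rw [MvPolynomial.vars_X, Finset.mem_singleton] at h''
    exact hij h''.symm
  · rw [IsRelPrime.neg_left_iff]
    rw [(MvPolynomial.X_prime (i := l)).irreducible.isRelPrime_iff_not_dvd]
    rintro ⟨q, hq⟩
    have := congrArg (MvPolynomial.eval (Pi.single i (1 : K))) hq
    simp [hil.symm] at this
    exact hl this

theorem not_dvd_of_eval {P Q : MvPolynomial (Fin 3) K} (z : Fin 3 → K)
    (h1 : eval z P = 0) (h2 : eval z Q ≠ 0) : ¬ P ∣ Q := by
  rintro ⟨q, rfl⟩
  simp [h1] at h2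

theorem sextic_sqfree (lam : K) (hl : lam ≠ 0) : Squarefree (hesseSextic lam) := by
  have i0 := conic_irred lam hl 0 1 2 (by decide) (by decide) (by decide)
  have i1 := conic_irred lam hl 1 0 2 (by decide) (by decide) (by decide)
  have i2 := conic_irred lam hl 2 0 1 (by decide) (by decide) (by decide)
  rw [hesseSextic, squarefree_mul_iff, squarefree_mul_iff]
  refine ⟨IsRelPrime.mul_left ?_ ?_, ⟨?_, i0.squarefree, i1.squarefree⟩, i2.squarefree⟩
  · rw [i0.isRelPrime_iff_not_dvd]
    exact not_dvd_of_eval ![0, 0, 1] (by simp) (by simpa using hl)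
  · rw [i1.isRelPrime_iff_not_dvd]
    exact not_dvd_of_eval ![0, 0, 1] (by simp) (by simpa using hl)
  · rw [i0.isRelPrime_iff_not_dvd]
    exact not_dvd_of_eval ![0, 1, 0] (by simp) (by simpa using hl)

theorem sextic_factor (lam : K) (hl : lam ≠ 0) (G : MvPolynomial (Fin 3) K)
    (hG : G ∣ hesseSextic lam) (hd : G.totalDegree ≠ 0) :
    (MvPolynomial.C lam * MvPolynomial.X 0 ^ 2 - MvPolynomial.X 1 * MvPolynomial.X 2) ∣ G ∨
    (MvPolynomial.C lam * MvPolynomial.X 1 ^ 2 - MvPolynomial.X 0 * MvPolynomial.X 2) ∣ G ∨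
    (MvPolynomial.C lam * MvPolynomial.X 2 ^ 2 - MvPolynomial.X 0 * MvPolynomial.X 1) ∣ G := by
  have i0 := conic_irred lam hl 0 1 2 (by decide) (by decide) (by decide)
  have i1 := conic_irred lam hl 1 0 2 (by decide) (by decide) (by decide)
  have i2 := conic_irred lam hl 2 0 1 (by decide) (by decide) (by decide)
  have hu : ¬ IsUnit G := fun h =>
    hd (MvPolynomial.isUnit_iff_totalDegree_of_isReduced.mp h).2
  have h0 : G ≠ 0 := by
    rintro rfl
    simp at hd
  obtain ⟨q, hq, hqG⟩ := WfDvdMonoid.exists_irreducible_factor hu h0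
  have hdv := hqG.trans hG
  rw [hesseSextic, hq.prime.dvd_mul, hq.prime.dvd_mul] at hdv
  rcases hdv with (h | h) | h
  · exact Or.inl (((hq.associated_of_dvd i0 h).symm.dvd).trans hqG)
  · exact Or.inr (Or.inl (((hq.associated_of_dvd i1 h).symm.dvd).trans hqG))
  · exact Or.inr (Or.inr (((hq.associated_of_dvd i2 h).symm.dvd).trans hqG))

theorem eval_zero_of_dvd {P Q : MvPolynomial (Fin 3) K} (z : Fin 3 → K)
    (h : P ∣ Q) (h1 : eval z P = 0) : eval z Q = 0 := by
  obtain ⟨q, rfl⟩ := h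
  simp [h1]

theorem sextic_conn (lam : K) (hl : lam ≠ 0) (G₁ G₂ : MvPolynomial (Fin 3) K)
    (hG : hesseSextic lam = G₁ * G₂) (h1 : G₁.totalDegree ≠ 0) (h2 : G₂.totalDegree ≠ 0) :
    ∃ z : Fin 3 → K, z ≠ 0 ∧ eval z G₁ = 0 ∧ eval z G₂ = 0 := by
  have nz : ∀ i : Fin 3, ∀ z : Fin 3 → K, z i = 1 → z ≠ 0 := by
    rintro i z h rfl
    simp at h
  rcases sextic_factor lam hl G₁ ⟨G₂, hG⟩ h1 with h | h | h <;>
  rcases sextic_factor lam hl G₂ ⟨G₁, hG.trans (mul_comm _ _)⟩ h2 with h' | h' | h' <;>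
  first
    | (refine ⟨![1, 1, lam], nz 0 _ (by simp), eval_zero_of_dvd _ h ?_,
        eval_zero_of_dvd _ h' ?_⟩ <;> simp <;> done)
    | (refine ⟨![1, lam, 1], nz 0 _ (by simp), eval_zero_of_dvd _ h ?_,
        eval_zero_of_dvd _ h' ?_⟩ <;> simp <;> done)
    | (refine ⟨![lam, 1, 1], nz 1 _ (by simp), eval_zero_of_dvd _ h ?_,
        eval_zero_of_dvd _ h' ?_⟩ <;> simp <;> done)

theorem singAt_of_two {A B D : MvPolynomial (Fin 3) K} (w : Fin 3 → K)
    (h : (eval w A = 0 ∧ eval w B = 0) ∨ (eval w A = 0 ∧ eval w D = 0) ∨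
      (eval w B = 0 ∧ eval w D = 0)) : SingAt (A * B * D) w := by
  rcases h with ⟨h, h'⟩ | ⟨h, h'⟩ | ⟨h, h'⟩ <;>
    exact ⟨by simp [h, h'], fun i => by simp [Derivation.leibniz, h, h']⟩

theorem infl_lines (h3 : (3 : K) ≠ 0) (lam : K) (hlam : lam ^ 3 ≠ 1) (w : Fin 3 → K) :
    IsInflLine (hessePencil lam) w ↔
        ∃ ω : K, ω ^ 3 = 1 ∧
          (propor w ![1, ω, lam * ω ^ 2] ∨ propor w ![1, lam * ω ^ 2, ω] ∨
            propor w ![lam * ω ^ 2, 1, ω]) := by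
  constructor
  · rintro ⟨hw, a, b, wa, wb, hab, hc⟩
    obtain ⟨ε, hε, hp⟩ := infl_pts h3 lam hlam a b hab hc
    rw [contact_hesse h3] at hc
    obtain ⟨c0, c1, -, -⟩ := hc
    obtain ⟨c, hg⟩ := orth_mult a b (hgrad lam a) hab
      (by simp [dotv, Fin.sum_univ_three, hgrad]; linear_combination c0)
      (by simp [dotv, Fin.sum_univ_three, hgrad]; linear_combination c1)
    obtain ⟨d, hd⟩ := orth_mult a b w hab wa wb
    have hd0 : d ≠ 0 := by
      rintro rfl
      exact hw (by simpa using hd)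
    have hwg : c • w = d • hgrad lam a := by
      rw [hg, hd, smul_comm]
    have hε4 : ε ^ 4 = -ε := by linear_combination ε * hε
    have hg0 : hgrad lam a ≠ 0 := by
      intro h
      have e0 := congrFun h 0
      have e1 := congrFun h 1
      rcases hp with ⟨s, hs, rfl⟩ | ⟨s, hs, rfl⟩ | ⟨s, hs, rfl⟩ <;>
        simp [hgrad, hs] at e0 e1
    have hc0 : c ≠ 0 := by
      rintro rfl
      exact hg0 (by simpa using hg)
    have hw2 : w = (c⁻¹ * d) • hgrad lam a := by
      rw [mul_smul, ← hwg, smul_smul, inv_mul_cancel₀ hc0, one_smul]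
    refine ⟨ε ^ 2, by linear_combination (ε ^ 3 - 1) * hε, ?_⟩
    rcases hp with ⟨s, hs, rfl⟩ | ⟨s, hs, rfl⟩ | ⟨s, hs, rfl⟩
    · refine Or.inl ⟨c⁻¹ * d * s ^ 2, mul_ne_zero (mul_ne_zero (inv_ne_zero hc0) hd0) (pow_ne_zero 2 hs), ?_⟩
      rw [hw2]
      ext j
      fin_cases j <;> simp [hgrad] <;> grind
    · refine Or.inr (Or.inl ⟨c⁻¹ * d * s ^ 2, mul_ne_zero (mul_ne_zero (inv_ne_zero hc0) hd0) (pow_ne_zero 2 hs), ?_⟩)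
      rw [hw2]
      ext j
      fin_cases j <;> simp [hgrad] <;> grind
    · refine Or.inr (Or.inr ⟨c⁻¹ * d * s ^ 2, mul_ne_zero (mul_ne_zero (inv_ne_zero hc0) hd0) (pow_ne_zero 2 hs), ?_⟩)
      rw [hw2]
      ext j
      fin_cases j <;> simp [hgrad] <;> grind
  · rintro ⟨ω, hω, h⟩
    have hε : (-ω ^ 2) ^ 3 + 1 = 0 := by linear_combination (-ω ^ 3 - 1) * hω
    rcases h with ⟨s, hs, rfl⟩ | ⟨s, hs, rfl⟩ | ⟨s, hs, rfl⟩
    · refine ⟨fun h => hs (by simpa using congrFun h 0), (1 : K) • ![1, -ω ^ 2, 0],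
        ![0, lam, -ω ^ 2], ?_, ?_, infl_conv h3 lam hlam (-ω ^ 2) hε _ _ 1 one_ne_zero
          (Or.inl ⟨rfl, rfl⟩)⟩
      · simp [dotv, Fin.sum_univ_three]; linear_combination -s * hω
      · simp [dotv, Fin.sum_univ_three]; linear_combination -s * lam * ω * hω
    · refine ⟨fun h => hs (by simpa using congrFun h 0), (1 : K) • ![1, 0, -ω ^ 2],
        ![0, -ω ^ 2, lam], ?_, ?_, infl_conv h3 lam hlam (-ω ^ 2) hε _ _ 1 one_ne_zero
          (Or.inr (Or.inl ⟨rfl, rfl⟩))⟩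
      · simp [dotv, Fin.sum_univ_three]; linear_combination -s * hω
      · simp [dotv, Fin.sum_univ_three]; linear_combination -s * lam * ω * hω
    · refine ⟨fun h => hs (by simpa using congrFun h 1), (1 : K) • ![0, 1, -ω ^ 2],
        ![-ω ^ 2, 0, lam], ?_, ?_, infl_conv h3 lam hlam (-ω ^ 2) hε _ _ 1 one_ne_zero
          (Or.inr (Or.inr ⟨rfl, rfl⟩))⟩
      · simp [dotv, Fin.sum_univ_three]; linear_combination -s * hω
      · simp [dotv, Fin.sum_univ_three]; linear_combination -s * lam * ω * hω

theorem hesse_pencil_inflection_data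
    (k : Type*) [Field k] [IsAlgClosed k] (h3 : (3 : k) ≠ 0)
    (lam : k) (hlam : lam ^ 3 ≠ 1) (hsm : IsSmoothCurve (hessePencil lam) 3) :
    -- the inflection points of `C_λ` are the nine points `[1,ε,0], [1,0,ε], [0,1,ε]`,
    -- with `ε³ + 1 = 0`:
    (∀ p : Fin 3 → k, p ≠ 0 →
      (IsInflPoint (hessePencil lam) p ↔
        ∃ ε : k, ε ^ 3 + 1 = 0 ∧
          (propor p ![1, ε, 0] ∨ propor p ![1, 0, ε] ∨ propor p ![0, 1, ε]))) ∧
    -- the inflection lines of `C_λ` are the nine lines `x + ωy + λω²z`,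
    -- `x + λω²y + ωz`, `λω²x + y + ωz`, with `ω³ = 1`:
    (∀ w : Fin 3 → k, w ≠ 0 →
      (IsInflLine (hessePencil lam) w ↔
        ∃ ω : k, ω ^ 3 = 1 ∧
          (propor w ![1, ω, lam * ω ^ 2] ∨ propor w ![1, lam * ω ^ 2, ω] ∨
            propor w ![lam * ω ^ 2, 1, ω]))) ∧
    -- if `λ ≠ 0`, the sextic `(λx²−yz)(λy²−xz)(λz²−xy)` in the dual plane is reduced,
    -- connected, and passes doubly through the nine points dual to the inflection
    -- lines of `C_λ`:
    (lam ≠ 0 →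
      Squarefree (hesseSextic lam) ∧
      (∀ G₁ G₂ : MvPolynomial (Fin 3) k, hesseSextic lam = G₁ * G₂ →
        G₁.totalDegree ≠ 0 → G₂.totalDegree ≠ 0 →
          ∃ z : Fin 3 → k, z ≠ 0 ∧ eval z G₁ = 0 ∧ eval z G₂ = 0) ∧
      (∀ w : Fin 3 → k, IsInflLine (hessePencil lam) w →
        SingAt (hesseSextic lam) w)) := by
  refine ⟨fun p hp => ⟨?_, ?_⟩, fun w _ => infl_lines h3 lam hlam w,
    fun hl => ⟨sextic_sqfree lam hl, sextic_conn lam hl, fun w hw => ?_⟩⟩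
  · rintro ⟨-, b, hb, hc⟩
    exact infl_pts h3 lam hlam p b hb hc
  · rintro ⟨ε, hε, ⟨c, hc, h⟩ | ⟨c, hc, h⟩ | ⟨c, hc, h⟩⟩
    · have H := infl_conv h3 lam hlam ε hε p _ c hc (Or.inl ⟨h, rfl⟩)
      exact ⟨by rw [eval_hesse]; exact ((contact_hesse h3 _ _ _).mp H.2).1, _, H⟩
    · have H := infl_conv h3 lam hlam ε hε p _ c hc (Or.inr (Or.inl ⟨h, rfl⟩))
      exact ⟨by rw [eval_hesse]; exact ((contact_hesse h3 _ _ _).mp H.2).1, _, H⟩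
    · have H := infl_conv h3 lam hlam ε hε p _ c hc (Or.inr (Or.inr ⟨h, rfl⟩))
      exact ⟨by rw [eval_hesse]; exact ((contact_hesse h3 _ _ _).mp H.2).1, _, H⟩
  · obtain ⟨ω, hω, ⟨s, -, rfl⟩ | ⟨s, -, rfl⟩ | ⟨s, -, rfl⟩⟩ :=
      (infl_lines h3 lam hlam w).mp hw
    · refine singAt_of_two _ (Or.inl ⟨?_, ?_⟩) <;> simp <;> grind
    · refine singAt_of_two _ (Or.inr (Or.inl ⟨?_, ?_⟩)) <;> simp <;> grind
    · refine singAt_of_two _ (Or.inr (Or.inr ⟨?_, ?_⟩)) <;> simp <;> grind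

end Infl
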